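/- (Core of Theorem 1.2(I)) Let U ⊆ E be a connected open neighborhood of 0, and let L be a set of holomorphic maps U → E which is a finite-dimensional complex vector subspace of the space of all maps U → E, is closed under the Lie bracket ⁅·,·⁆, and contains the restriction to U of the Euler vector field η(z) = z and of every constant map. Then every f ∈ L is the restriction to U of a polynomial map: there exist d ∈ ℕ and continuous ℂ-multilinear maps A_j : E^j → E for 0 ≤ j ≤ d such that f(z) = Σ_{j=0}^{d} A_j(z,…,z) for all z ∈ U. -/

import Mathlib

open Filter Topology

/-- One-variable Euler operator acts on the k-th Taylor coefficient by k - 1. -/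
theorem aux_euler {F : Type*} [NormedAddCommGroup F] [NormedSpace ℂ F] [CompleteSpace F]
    {φ ψ : ℂ → F} (hφ : AnalyticAt ℂ φ 0)
    (h : ψ =ᶠ[𝓝 0] fun t => t • deriv φ t - φ t) (k : ℕ) :
    iteratedDeriv k ψ 0 = ((k : ℂ) - 1) • iteratedDeriv k φ 0 := by
  have key : ∀ k : ℕ, iteratedDeriv k ψ =ᶠ[𝓝 0]
      fun t => t • iteratedDeriv (k + 1) φ t + ((k : ℂ) - 1) • iteratedDeriv k φ t := by
    intro k
    induction k with
    | zero =>
      filter_upwards [h] with t ht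
      simp [ht, iteratedDeriv_one, sub_eq_add_neg]
    | succ k ih =>
      rw [iteratedDeriv_succ]
      have han : ∀ n : ℕ, ∀ᶠ t in 𝓝 (0 : ℂ), DifferentiableAt ℂ (iteratedDeriv n φ) t := by
        intro n
        have h1 := (hφ.iterated_deriv n).eventually_analyticAt
        filter_upwards [h1] with t ht
        rw [iteratedDeriv_eq_iterate]
        exact ht.differentiableAt
      filter_upwards [ih.deriv, han k, han (k + 1)] with t ht h1 h2
      rw [ht]
      have e1 : HasDerivAt (iteratedDeriv k φ) (iteratedDeriv (k + 1) φ t) t := by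
        rw [iteratedDeriv_succ]; exact h1.hasDerivAt
      have e2 : HasDerivAt (iteratedDeriv (k + 1) φ) (iteratedDeriv (k + 1 + 1) φ t) t := by
        rw [iteratedDeriv_succ (n := k + 1)]; exact h2.hasDerivAt
      have e3 := ((hasDerivAt_id t).smul e2).add (e1.const_smul ((k : ℂ) - 1))
      refine e3.deriv.trans ?_
      simp only [id, one_smul]
      push_cast
      module
  have := (key k).self_of_nhds
  simpa using this

/-- Identity theorem for complex differentiable maps on a connected open set. -/
theorem aux_identity {E F : Type*} [NormedAddCommGroup E] [NormedSpace ℂ E]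
    [NormedAddCommGroup F] [NormedSpace ℂ F] [CompleteSpace F]
    {U : Set E} (hUo : IsOpen U) (hUc : IsPreconnected U) {z₀ : E} (hz₀ : z₀ ∈ U) {g : E → F}
    (hg : DifferentiableOn ℂ g U) (h : ∀ᶠ z in 𝓝 z₀, g z = 0) : ∀ z ∈ U, g z = 0 := by
  have hsub : U ⊆ {z | ∀ᶠ w in 𝓝 z, g w = 0} := by
    refine hUc.subset_of_closure_inter_subset isOpen_setOfPred_eventually_nhds ⟨z₀, hz₀, h⟩ ?_
    rintro z ⟨hzc, hzU⟩
    obtain ⟨r, hr, hball⟩ := Metric.isOpen_iff.1 hUo z hzU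
    obtain ⟨w, hw, hwz⟩ := Metric.mem_closure_iff.1 hzc r hr
    have hwB : w ∈ Metric.ball z r := by rwa [Metric.mem_ball, dist_comm]
    filter_upwards [Metric.ball_mem_nhds z hr] with v hv
    let ℓ : ℂ → E := fun t => w + t • (v - w)
    have hℓ : Differentiable ℂ ℓ := by fun_prop
    have hS : IsPreconnected (ℓ ⁻¹' Metric.ball z r) := by
      apply Convex.isPreconnected
      intro a ha b hb p q hp hq hpq
      have hb' := convex_ball z r ha hb hp hq hpq
      have : ℓ (p • a + q • b) = p • ℓ a + q • ℓ b := by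
        have hpq' : w = p • w + q • w := by rw [← add_smul, hpq, one_smul]
        simp only [ℓ, add_smul, smul_add, smul_assoc]
        nth_rewrite 1 [hpq']
        abel
      rw [Set.mem_preimage, this]
      exact hb'
    have hSo : IsOpen (ℓ ⁻¹' Metric.ball z r) := Metric.isOpen_ball.preimage hℓ.continuous
    have hd : DifferentiableOn ℂ (fun t => g (ℓ t)) (ℓ ⁻¹' Metric.ball z r) :=
      hg.comp hℓ.differentiableOn (fun t ht => hball ht)
    have han := hd.analyticOnNhd hSo
    have h0 : (0 : ℂ) ∈ ℓ ⁻¹' Metric.ball z r := by simpa [ℓ] using hwB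
    have hev : (fun t => g (ℓ t)) =ᶠ[𝓝 0] 0 := by
      have : Tendsto ℓ (𝓝 0) (𝓝 w) := by
        have := hℓ.continuous.tendsto 0
        simpa [ℓ] using this
      exact this.eventually hw
    have := han.eqOn_zero_of_preconnected_of_eventuallyEq_zero hS h0 hev
      (show (1 : ℂ) ∈ _ by simpa [ℓ] using hv)
    simpa [ℓ] using this
  intro z hz
  exact (hsub hz).self_of_nhds

/-- Derivatives along lines through a point. -/
theorem aux_line {E F : Type*} [NormedAddCommGroup E] [NormedSpace ℂ E]
    [NormedAddCommGroup F] [NormedSpace ℂ F] {U : Set E} (hUo : IsOpen U) (h0 : (0 : E) ∈ U)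
    {f : E → F} (hf : ∀ n : ℕ, ContDiffOn ℂ n f U) (y : E) (k : ℕ) :
    iteratedDeriv k (fun t : ℂ => f (0 + t • y)) 0 = iteratedFDeriv ℂ k f 0 (fun _ => y) := by
  have hc : Continuous (fun t : ℂ => (0 : E) + t • y) := by fun_prop
  have hU : ∀ᶠ t in 𝓝 (0 : ℂ), (0 : E) + t • y ∈ U :=
    hc.continuousAt.eventually_mem (hUo.mem_nhds (by simpa using h0))
  have key : ∀ k : ℕ, iteratedDeriv k (fun t : ℂ => f (0 + t • y)) =ᶠ[𝓝 0]
      fun t => iteratedFDeriv ℂ k f (0 + t • y) (fun _ => y) := by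
    intro k
    induction k with
    | zero => exact Eventually.of_forall fun t => by simp
    | succ k ih =>
      rw [iteratedDeriv_succ]
      filter_upwards [ih.deriv, hU] with t ht htU
      rw [ht]
      apply ContDiffAt.deriv_fderiv_add_smul
      exact_mod_cast (hf (k + 1)).contDiffAt (hUo.mem_nhds htU)
  simpa using (key k).self_of_nhds

/-- Core of Theorem 1.2(I): let `U` be a connected open neighborhood of `0` in `E` and `L` a
finite-dimensional complex vector space of holomorphic vector fields on `U` (identified with
holomorphic maps `U → E`), closed under the Lie bracket and containing the Euler vector field
`η(z) = z` and all constant vector fields. Then every element of `L` is (the restriction to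
`U` of) a polynomial map. -/
theorem core_thm_1_2_I {E : Type*} [NormedAddCommGroup E] [NormedSpace ℂ E]
    [FiniteDimensional ℂ E]
    (U : Set E) (hUo : IsOpen U) (hUc : IsConnected U) (h0 : (0 : E) ∈ U)
    (L : Submodule ℂ (E → E)) (hfin : FiniteDimensional ℂ L)
    (hhol : ∀ f ∈ L, DifferentiableOn ℂ f U)
    (hbracket : ∀ f ∈ L, ∀ g ∈ L, ∃ h ∈ L,
      ∀ z ∈ U, h z = fderiv ℂ f z (g z) - fderiv ℂ g z (f z))
    (heuler : ∃ h ∈ L, ∀ z ∈ U, h z = z)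
    (hconst : ∀ c : E, ∃ h ∈ L, ∀ z ∈ U, h z = c) :
    ∀ f ∈ L, ∃ (d : ℕ)
      (A : ∀ j : Fin (d + 1), ContinuousMultilinearMap ℂ (fun _ : Fin (j : ℕ) => E) E),
      ∀ z ∈ U, f z = ∑ j : Fin (d + 1), A j (fun _ => z) := by
  have hline : ∀ y : E, Continuous (fun t : ℂ => (0 : E) + t • y) := fun y => by fun_prop
  have hlineU : ∀ y : E, ∀ᶠ t in 𝓝 (0 : ℂ), (0 : E) + t • y ∈ U := fun y =>
    (hline y).continuousAt.eventually_mem (hUo.mem_nhds (by simpa using h0))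
  have : CompleteSpace E := FiniteDimensional.complete ℂ E
  -- smoothness
  have hsm : ∀ n : ℕ, ∀ f ∈ L, ContDiffOn ℂ n f U := by
    intro n
    induction n with
    | zero => intro f hf; exact_mod_cast contDiffOn_zero.2 (hhol f hf).continuousOn
    | succ n ih =>
      intro f hf
      push_cast
      rw [contDiffOn_succ_iff_fderiv_of_isOpen hUo]
      refine ⟨hhol f hf, fun h => absurd h (by simp), ?_⟩
      rw [contDiffOn_clm_apply]
      intro c
      obtain ⟨g, hg, hgc⟩ := hconst c
      obtain ⟨h, hh, hhe⟩ := hbracket f hf g hg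
      refine (ih h hh).congr fun z hz => ?_
      have : fderiv ℂ g z = 0 := by
        have : g =ᶠ[𝓝 z] fun _ => c := by
          filter_upwards [hUo.mem_nhds hz] with w hw using hgc w hw
        rw [this.fderiv_eq]; simp
      rw [hhe z hz, this, hgc z hz]; simp
  have hana : ∀ f ∈ L, ∀ y : E, AnalyticAt ℂ (fun t : ℂ => f (0 + t • y)) 0 := by
    intro f hf y
    refine DifferentiableOn.analyticAt (s := (fun t : ℂ => (0 : E) + t • y) ⁻¹' U) ?_ (hlineU y)
    exact (hhol f hf).comp (by fun_prop) (fun t ht => ht)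
  -- the Euler operator
  have hT : ∀ f : L, ∃ h : L, ∀ z ∈ U, h.1 z = fderiv ℂ f.1 z z - f.1 z := by
    rintro ⟨f, hf⟩
    obtain ⟨g, hg, hge⟩ := heuler
    obtain ⟨h, hh, hhe⟩ := hbracket f hf g hg
    refine ⟨⟨h, hh⟩, fun z hz => ?_⟩
    have : fderiv ℂ g z = ContinuousLinearMap.id ℂ E := by
      have : g =ᶠ[𝓝 z] id := by
        filter_upwards [hUo.mem_nhds hz] with w hw using hge w hw
      rw [this.fderiv_eq]; simp
    simp only [hhe z hz, this, hge z hz]; simp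
  choose T hT using hT
  have hTk : ∀ (k : ℕ) (y : E) (f : L), iteratedDeriv k (fun t : ℂ => (T f).1 (0 + t • y)) 0
      = ((k : ℂ) - 1) • iteratedDeriv k (fun t : ℂ => f.1 (0 + t • y)) 0 := by
    intro k y f
    refine aux_euler (hana f.1 f.2 y) ?_ k
    filter_upwards [hlineU y] with t ht
    rw [DifferentiableAt.deriv_comp_add_smul ((hhol f.1 f.2).differentiableAt (hUo.mem_nhds ht)),
      hT f _ ht]
    simp
  have hTn : ∀ (n k : ℕ) (y : E) (f : L),
      iteratedDeriv k (fun t : ℂ => (T^[n] f).1 (0 + t • y)) 0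
      = ((k : ℂ) - 1) ^ n • iteratedDeriv k (fun t : ℂ => f.1 (0 + t • y)) 0 := by
    intro n k y f
    induction n with
    | zero => simp
    | succ n ih => rw [Function.iterate_succ_apply', hTk, ih, smul_smul, pow_succ']
  intro f hf
  have hdep : ¬ LinearIndependent ℂ (fun n : ℕ => T^[n] ⟨f, hf⟩) := by
    intro h
    exact not_finite_iff_infinite.2 inferInstance h.finite
  obtain ⟨s, c, hsum, i₀, hi₀, hci₀⟩ := not_linearIndependent_iff.1 hdep
  let q : Polynomial ℂ := ∑ i ∈ s, Polynomial.monomial i (c i)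
  have hq : q ≠ 0 := by
    intro h
    apply hci₀
    have : q.coeff i₀ = c i₀ := by
      simp [q, Polynomial.coeff_monomial, hi₀]
    rw [← this, h, Polynomial.coeff_zero]
  have hqk : ∀ (k : ℕ) (y : E), q.eval ((k : ℂ) - 1) •
      iteratedDeriv k (fun t : ℂ => f (0 + t • y)) 0 = 0 := by
    intro k y
    have e1 : (fun t : ℂ => ∑ i ∈ s, c i • (T^[i] ⟨f, hf⟩).1 (0 + t • y)) = fun _ => 0 := by
      funext t
      have := congrArg (fun g : L => g.1 (0 + t • y)) hsum
      simpa [Finset.sum_apply] using this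
    have e2 := congrArg (fun φ => iteratedDeriv k φ (0 : ℂ)) e1
    rw [iteratedDeriv_fun_sum (fun i _ =>
      ((hana _ (T^[i] ⟨f, hf⟩).2 y).contDiffAt).const_smul (c i))] at e2
    simp only [iteratedDeriv_fun_const_smul_field, hTn, smul_smul, ← Finset.sum_smul] at e2
    simp only [q, Polynomial.eval_finsetSum, Polynomial.eval_monomial]
    rw [e2]
    simp
  obtain ⟨d, hd⟩ : ∃ d : ℕ, ∀ k : ℕ, d < k → q.eval ((k : ℂ) - 1) ≠ 0 := by
    have hfinite : {k : ℕ | q.eval ((k : ℂ) - 1) = 0}.Finite := by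
      refine Set.Finite.subset ((Polynomial.finite_setOfPred_isRoot hq).preimage
        (f := fun k : ℕ => (k : ℂ) - 1) ?_) (fun k hk => hk)
      intro a _ b _ hab
      simpa using hab
    obtain ⟨d, hd⟩ := hfinite.bddAbove
    exact ⟨d, fun k hk h => absurd (hd h) (not_le.2 hk)⟩
  have hvan : ∀ k : ℕ, d < k → ∀ y : E,
      iteratedDeriv k (fun t : ℂ => f (0 + t • y)) 0 = 0 := fun k hk y =>
    (smul_eq_zero.1 (hqk k y)).resolve_left (hd k hk)
  refine ⟨d, fun j => ((Nat.factorial j : ℂ)⁻¹) • iteratedFDeriv ℂ j f 0, ?_⟩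
  have hpoly : Differentiable ℂ (fun z : E => ∑ j : Fin (d + 1),
      (((Nat.factorial j : ℂ)⁻¹) • iteratedFDeriv ℂ j f 0) (fun _ => z)) := by
    refine Differentiable.fun_sum fun j _ => ?_
    exact ((ContinuousMultilinearMap.contDiff (n := 1) _).differentiable (by simp)).comp (by fun_prop)
  have hmain := aux_identity (g := fun z => f z - ∑ j : Fin (d + 1),
      (((Nat.factorial j : ℂ)⁻¹) • iteratedFDeriv ℂ j f 0) (fun _ => z)) hUo hUc.isPreconnected h0
      ((hhol f hf).sub hpoly.differentiableOn) ?_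
  · intro z hz
    exact sub_eq_zero.1 (hmain z hz)
  obtain ⟨r, hr, hball⟩ := Metric.isOpen_iff.1 hUo 0 h0
  have hr2 : 0 < r / 2 := by positivity
  filter_upwards [Metric.ball_mem_nhds (0 : E) hr2] with z hz
  rw [sub_eq_zero]
  have hdf : DifferentiableOn ℂ (fun t : ℂ => f (0 + t • z)) (Metric.ball 0 2) := by
    refine (hhol f hf).comp (by fun_prop) (fun t ht => hball ?_)
    simp only [Metric.mem_ball, dist_zero_right] at ht hz ⊢
    rw [zero_add, norm_smul]
    nlinarith [norm_nonneg t, norm_nonneg z]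
  have hs := Complex.hasSum_taylorSeries_on_ball hdf (z := 1) (by simp)
  have hz' : ∀ n ∉ Finset.range (d + 1), ((n.factorial : ℂ))⁻¹ • ((1 : ℂ) - 0) ^ n •
      iteratedDeriv n (fun t : ℂ => f (0 + t • z)) 0 = 0 := by
    intro n hn
    rw [hvan n (by rw [Finset.mem_range] at hn; omega)]; simp
  have hs2 := hasSum_sum_of_ne_finset_zero (L := SummationFilter.unconditional ℕ) hz'
  have heq := hs.unique hs2
  simp only [zero_add, one_smul] at heq
  rw [heq, Finset.sum_range]
  refine Finset.sum_congr rfl fun j _ => ?_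
  have := aux_line hUo h0 (fun n => hsm n f hf) z j
  simp only [zero_add] at this
  rw [this]
  simp
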